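/- arXiv:1512.07467 — 3 statements merged into one kernel-verified Lean document; each statement's English description precedes it below -/
import Mathlib

section
/- Let n > 1. There exists b ∈ GF(2^{3n})* such that x + b·x^{2^{2n+1} - 1} ∉ GF(2^n) for every x ∈ GF(2^{3n})*. -/
open Polynomial in
/-- A polynomial expression in `c, c ^ q, c ^ q ^ 2` which vanishes at few points of a field with
`q ^ 3` elements. -/
theorem exists_conjugate_expr_ne_zero {K : Type*} [Field K] [Fintype K] {q : ℕ} (hq : 4 ≤ q)
    (hK : Fintype.card K = q ^ 3) :
    ∃ c : K, c ^ q ≠ c ^ 2 ∧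
      (c ^ q ^ 2) ^ 3 * c ^ q + c ^ 3 * c ^ q ^ 2 + (c ^ q) ^ 3 * c + c ^ 3 * (c ^ q) ^ 2 +
        (c ^ q ^ 2) ^ 3 * c ^ 2 + (c ^ q) ^ 3 * (c ^ q ^ 2) ^ 2 +
        c * c ^ q * c ^ q ^ 2 *
          (c + c ^ q + c ^ q ^ 2 + (c * c ^ q + c ^ q * c ^ q ^ 2 + c * c ^ q ^ 2)) ≠ 0 := by
  have hq2 : 4 * q ≤ q ^ 2 := by nlinarith
  have hq3 : 4 * q ^ 2 ≤ q ^ 3 := by nlinarith [sq_nonneg q]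
  set m := 3 * q ^ 2 + q with hm
  let E : K[X] := X ^ (3 + q ^ 2) + X ^ (3 * q + 1) + X ^ (3 + 2 * q) + X ^ (3 * q ^ 2 + 2) +
    X ^ (3 * q + 2 * q ^ 2) + X ^ (q ^ 2 + q + 2) + X ^ (q ^ 2 + 2 * q + 1) +
    X ^ (2 * q ^ 2 + q + 1) + X ^ (q ^ 2 + 2 * q + 2) + X ^ (2 * q ^ 2 + 2 * q + 1) +
    X ^ (2 * q ^ 2 + q + 2)
  have hmem : ∀ k < m, (X ^ k : K[X]) ∈ degreeLT K m := fun k hk => by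
    rw [mem_degreeLT, degree_X_pow]; exact_mod_cast hk
  have hE : E.degree < m := by
    rw [← mem_degreeLT]
    simp only [E]
    repeat' first | apply add_mem | apply hmem
    all_goals omega
  have hA : (X ^ m + E).Monic := monic_X_pow_add hE
  have hA' : (X ^ m + E).natDegree = m := by
    rw [natDegree_add_eq_left_of_degree_lt (by rwa [degree_X_pow]), natDegree_X_pow]
  have hX2 : (-X ^ 2 : K[X]).degree < q := by
    rw [degree_neg, degree_X_pow]; exact_mod_cast (by omega : 2 < q)
  have hB : (X ^ q + -X ^ 2 : K[X]).Monic := monic_X_pow_add hX2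
  have hB' : (X ^ q + -X ^ 2 : K[X]).natDegree = q := by
    rw [natDegree_add_eq_left_of_degree_lt (by rwa [degree_X_pow]), natDegree_X_pow]
  by_contra! hcon
  refine (hA.mul hB).ne_zero (eq_zero_of_natDegree_lt_card_of_eval_eq_zero _
    (f := (id : K → K)) Function.injective_id (fun c => ?_) ?_)
  · rw [id, eval_mul]
    by_cases h : c ^ q = c ^ 2
    · simp [h]
    · refine mul_eq_zero_of_left ?_ _
      rw [← hcon c h]
      simp only [E, hm, eval_add, eval_pow, eval_X]
      ring
  · rw [hA.natDegree_mul hB, hA', hB', hK]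
    omega

section CubicAutomorphism

variable {K : Type*} [Field K] (σ : K →+* K)

/-- The norm of `x` with respect to an endomorphism `σ` of order dividing three. -/
def cubicNorm (x : K) : K := x * σ x * σ (σ x)

/-- The map `w ↦ w (σ w + 1)² / (w + 1)²`, which preserves `cubicNorm σ` away from `w = 1`. -/
def twistMap (w : K) : K := w * (σ w + 1) ^ 2 / (w + 1) ^ 2

variable {σ}

theorem cubicNorm_mul (x y : K) : cubicNorm σ (x * y) = cubicNorm σ x * cubicNorm σ y := by
  simp only [cubicNorm, map_mul]; ring

theorem cubicNorm_map (hσ : ∀ x, σ (σ (σ x)) = x) (x : K) :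
    cubicNorm σ (σ x) = cubicNorm σ x := by
  simp only [cubicNorm, hσ]; ring

theorem cubicNorm_ne_zero {x : K} (hx : x ≠ 0) : cubicNorm σ x ≠ 0 := by
  simp [cubicNorm, hx]

theorem cubicNorm_one : cubicNorm σ 1 = 1 := by simp [cubicNorm]

theorem cubicNorm_twistMap (hσ : ∀ x, σ (σ (σ x)) = x) {w : K} (hw : w + 1 ≠ 0) :
    cubicNorm σ (twistMap σ w) = cubicNorm σ w := by
  have h : twistMap σ w * ((w + 1) * (w + 1)) = w * (σ (w + 1) * σ (w + 1)) := by
    rw [twistMap, map_add, map_one]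
    field_simp
  have h' := congrArg (cubicNorm σ) h
  simp only [cubicNorm_mul, cubicNorm_map hσ] at h'
  exact mul_right_cancel₀ (mul_ne_zero (cubicNorm_ne_zero hw) (cubicNorm_ne_zero hw)) h'

theorem exists_twistMap_eq [CharP K 2] (hσ : ∀ x, σ (σ (σ x)) = x) {c : K}
    (hc : c ≠ σ c ^ 2) (hN : cubicNorm σ (c + c ^ 2) ≠ cubicNorm σ (c + σ c ^ 2)) :
    ∃ v w : K, v ≠ w ∧ cubicNorm σ v ≠ 1 ∧ cubicNorm σ w ≠ 1 ∧
      twistMap σ v = twistMap σ w := by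
  have h2 : (2 : K) = 0 := CharTwo.two_eq_zero
  have hd : c + σ c ^ 2 ≠ 0 := fun h => hc (CharTwo.add_eq_zero.mp h)
  have hd' : σ c + σ (σ c) ^ 2 ≠ 0 := by simpa using (map_ne_zero σ).mpr hd
  have hc0 : c ≠ 0 := by rintro rfl; simp at hN
  have hr0 : σ c ≠ 0 := (map_ne_zero σ).mpr hc0
  have hcr : c + σ c ≠ 0 := by
    intro h
    have h' := CharTwo.add_eq_zero.mp h
    exact hN (by rw [← h'])
  have hv1 : (c + c ^ 2) / (c + σ c ^ 2) + 1 = (c + σ c) ^ 2 / (c + σ c ^ 2) := by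
    field_simp
    linear_combination (c - c * σ c) * h2
  have hw1 : σ c ^ 2 * (c + 1) / (c * (c + σ c ^ 2)) + 1 =
      (c + σ c) ^ 2 / (c * (c + σ c ^ 2)) := by
    field_simp
    linear_combination (c * σ c ^ 2 - c * σ c) * h2
  have hT : twistMap σ ((c + c ^ 2) / (c + σ c ^ 2)) =
      twistMap σ (σ c ^ 2 * (c + 1) / (c * (c + σ c ^ 2))) := by
    have hv2 := congrArg σ hv1
    have hw2 := congrArg σ hw1
    rw [map_add, map_one] at hv2 hw2
    rw [twistMap, twistMap, hv1, hw1, hv2, hw2]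
    simp only [map_div₀, map_mul, map_add, map_pow]
    field_simp
    ring
  have hNv : cubicNorm σ ((c + c ^ 2) / (c + σ c ^ 2)) ≠ 1 := by
    intro h
    apply hN
    rw [← one_mul (cubicNorm σ (c + σ c ^ 2)), ← h, ← cubicNorm_mul, div_mul_cancel₀ _ hd]
  refine ⟨_, _, ?_, hNv, ?_, hT⟩
  · intro h
    have h' : (c + σ c) ^ 2 * (c + 1) = 0 := by
      field_simp at h
      linear_combination h + (c * σ c * (c + 1) + σ c ^ 2 * (c + 1)) * h2
    rcases mul_eq_zero.mp h' with h' | h'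
    · exact hcr (pow_eq_zero_iff two_ne_zero |>.mp h')
    · have hc1 : c = 1 := CharTwo.add_eq_zero.mp h'
      exact hc (by simp [hc1])
  · have e : cubicNorm σ (twistMap σ ((c + c ^ 2) / (c + σ c ^ 2))) ≠ 1 := by
      rwa [cubicNorm_twistMap hσ]
      rw [hv1]
      exact div_ne_zero (pow_ne_zero _ hcr) hd
    rwa [hT, cubicNorm_twistMap hσ] at e
    rw [hw1]
    exact div_ne_zero (pow_ne_zero _ hcr) (mul_ne_zero hc0 hd)

theorem exists_notMem_range_twistMap [Finite K] [CharP K 2] (hσ : ∀ x, σ (σ (σ x)) = x) {c : K}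
    (hc : c ≠ σ c ^ 2) (hN : cubicNorm σ (c + c ^ 2) ≠ cubicNorm σ (c + σ c ^ 2)) :
    ∃ b : K, cubicNorm σ b ≠ 1 ∧ ∀ w, w + 1 ≠ 0 → twistMap σ w ≠ b := by
  obtain ⟨v, w, hvw, hv, hw, hT⟩ := exists_twistMap_eq hσ hc hN
  have h1 : ∀ u : K, cubicNorm σ u ≠ 1 → u + 1 ≠ 0 := fun u hu h => by
    rw [CharTwo.add_eq_zero.mp h] at hu
    exact hu cubicNorm_one
  let f : {u : K // cubicNorm σ u ≠ 1} → {u : K // cubicNorm σ u ≠ 1} :=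
    fun u => ⟨twistMap σ u, by rw [cubicNorm_twistMap hσ (h1 u u.2)]; exact u.2⟩
  have hf : ¬ Function.Surjective f := by
    rw [← Finite.injective_iff_surjective]
    intro hinj
    exact hvw (congrArg Subtype.val (@hinj ⟨v, hv⟩ ⟨w, hw⟩ (Subtype.ext hT)))
  simp only [Function.Surjective, not_forall, not_exists] at hf
  obtain ⟨⟨b, hb⟩, hbf⟩ := hf
  refine ⟨b, hb, fun u hu huT => hbf ⟨u, ?_⟩ (Subtype.ext huT)⟩
  rwa [← cubicNorm_twistMap hσ hu, huT]

theorem map_ne_self_of_notMem_range_twistMap [CharP K 2] (hσ : ∀ x, σ (σ (σ x)) = x) {b : K}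
    (hb : cubicNorm σ b ≠ 1) (hbT : ∀ w, w + 1 ≠ 0 → twistMap σ w ≠ b) {x : K} (hx : x ≠ 0) :
    σ (x + b * (σ x ^ 2 / x)) ≠ x + b * (σ x ^ 2 / x) := by
  have h2 : (2 : K) = 0 := CharTwo.two_eq_zero
  have hsx : σ x ≠ 0 := (map_ne_zero σ).mpr hx
  intro hg
  obtain ⟨g, hgdef⟩ : ∃ g, g = x + b * (σ x ^ 2 / x) := ⟨_, rfl⟩
  rw [← hgdef] at hg
  have hgx : g * x = x ^ 2 + b * σ x ^ 2 := by rw [hgdef]; field_simp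
  by_cases hg0 : g = 0
  · have h : x * x = b * (σ x * σ x) := by
      linear_combination (-b * σ x ^ 2) * h2 + x * hg0 - hgx
    have h' := congrArg (cubicNorm σ) h
    simp only [cubicNorm_mul, cubicNorm_map hσ] at h'
    have hn := cubicNorm_ne_zero (σ := σ) hx
    exact hb (mul_right_cancel₀ (mul_ne_zero hn hn) (by rw [← h', one_mul]))
  · have hw : g / x + 1 + 1 = g / x := by linear_combination h2
    have hw' : σ (g / x + 1) + 1 = g / σ x := by
      rw [map_add, map_one, map_div₀, hg]; linear_combination h2
    refine hbT (g / x + 1) (by rw [hw]; exact div_ne_zero hg0 hx) ?_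
    rw [twistMap, hw, hw']
    field_simp
    linear_combination hgx + x ^ 2 * h2

end CubicAutomorphism

/-- Proposition 3.9 of the paper: there is b ∈ GF(2^{3n})* with
x + b·x^{2^{2n+1}-1} ∉ GF(2^n) for every nonzero x ∈ GF(2^{3n}).  The subfield
GF(2^n) is the fixed field of the 2^n-power Frobenius. -/
theorem stmt11 (n : ℕ) (hn : 1 < n)
    (K : Type*) [Field K] [Fintype K] (hK : Nat.card K = 2 ^ (3 * n)) :
    ∃ b : K, b ≠ 0 ∧ ∀ x : K, x ≠ 0 →
      (x + b * x ^ (2 ^ (2 * n + 1) - 1)) ^ 2 ^ n ≠ x + b * x ^ (2 ^ (2 * n + 1) - 1) := by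
  have hcard : Fintype.card K = 2 ^ (3 * n) := by rw [← Nat.card_eq_fintype_card, hK]
  have : Fact (Nat.Prime 2) := ⟨Nat.prime_two⟩
  have : CharP K 2 := charP_of_card_eq_prime_pow hcard
  have h2 : (2 : K) = 0 := CharTwo.two_eq_zero
  have hpow : ∀ x : K, x ^ 2 ^ (3 * n) = x := fun x => by rw [← hcard, FiniteField.pow_card]
  let σ : K →+* K := iterateFrobenius K 2 (2 * n)
  have hσ1 : ∀ x : K, σ x = x ^ 2 ^ (2 * n) := fun x => iterateFrobenius_def ..
  have hσ2 : ∀ x : K, σ (σ x) = x ^ 2 ^ n := fun x => by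
    rw [hσ1, hσ1, ← pow_mul, ← pow_add, show 2 * n + 2 * n = 3 * n + n by ring, pow_add, pow_mul,
      hpow]
  have hσ : ∀ x : K, σ (σ (σ x)) = x := fun x => by
    rw [hσ2, hσ1, ← pow_mul, ← pow_add, show 2 * n + n = 3 * n by ring, hpow]
  have hq : 4 ≤ 2 ^ n := Nat.pow_le_pow_right (n := 2) two_pos hn
  obtain ⟨c, hc, hD⟩ := exists_conjugate_expr_ne_zero hq
    (K := K) (by rw [hcard, ← pow_mul, mul_comm])
  rw [← pow_mul 2 n 2, mul_comm n 2, ← hσ1, ← hσ2] at hD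
  rw [← hσ2] at hc
  obtain ⟨b, hb, hbT⟩ := exists_notMem_range_twistMap hσ (c := c)
    (fun h => hc (by
      have h' := congrArg (fun x => σ (σ x)) h
      simpa only [map_pow, hσ] using h'))
    (fun h => hD (by
      simp only [cubicNorm, map_add, map_pow, hσ] at h
      linear_combination -h + c * σ c * σ (σ c) *
        (c + σ c + σ (σ c) + (c * σ c + σ c * σ (σ c) + c * σ (σ c))) * h2))
  refine ⟨b, ?_, fun x hx hg => map_ne_self_of_notMem_range_twistMap hσ hb hbT hx ?_⟩
  · rintro rfl
    exact hbT 0 (by simp) (by simp [twistMap])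
  · have hxd : x ^ (2 ^ (2 * n + 1) - 1) = σ x ^ 2 / x := by
      rw [eq_div_iff hx, ← pow_succ, Nat.sub_add_cancel Nat.one_le_two_pow, hσ1, ← pow_mul,
        ← pow_succ]
    rw [hxd, ← hσ2] at hg
    have h := congrArg σ hg
    rw [hσ] at h
    exact h.symm
end

section
/- Let n > 1 and let b ∈ GF(2^{3n})* satisfy N_{2^{3n}/2^n}(b) ≠ 1 and x + b·x^{2^{2n+1}-1} ∉ GF(2^n) for all x ∈ GF(2^{3n})*. Let ω ∈ GF(2^{2n}) \ GF(2^n). Then L_U = { GF(2^{2n})·(x^2 + b·x^{2^{2n+1}} + xω) : x ∈ GF(2^{3n})* } is a scattered F_2-linear set of rank 3n in PG(2, 2^{2n}). -/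
open Polynomial in
theorem FiniteField.natCard_setOf_pow_eq_self {K : Type*} [Field K] [Finite K] {p N m : ℕ}
    [hp : Fact p.Prime] (hK : Nat.card K = p ^ N) (hm0 : m ≠ 0) (hm : m ∣ N) :
    Nat.card {x : K | x ^ p ^ m = x} = p ^ m := by
  have := Fintype.ofFinite K
  have := charP_of_card_eq_prime_pow (R := K) (p := p) (f := N)
    (by rw [← Nat.card_eq_fintype_card, hK])
  have hN : N ≠ 0 := by
    rintro rfl
    exact (Finite.one_lt_card (α := K)).ne' (by simpa using hK)
  have hne := FiniteField.X_pow_card_pow_sub_X_ne_zero K hm0 hp.out.one_lt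
  have hne' := FiniteField.X_pow_card_pow_sub_X_ne_zero K hN hp.out.one_lt
  have hs : (X ^ p ^ N - X : K[X]).Splits := by
    rw [splits_iff_card_roots, FiniteField.X_pow_card_pow_sub_X_natDegree_eq K hN hp.out.one_lt,
      ← hK, Nat.card_eq_fintype_card, FiniteField.roots_X_pow_card_sub_X]
    simp
  have hd : (X ^ p ^ m - X : K[X]) ∣ X ^ p ^ N - X := dvd_pow_pow_sub_self_of_dvd hm
  have hset : {x : K | x ^ p ^ m = x} = (X ^ p ^ m - X : K[X]).rootSet K := by
    ext x
    simp [mem_rootSet, hne, sub_eq_zero]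
  have key := card_rootSet_eq_natDegree (K := K)
    (galois_poly_separable (K := K) p (p ^ m) (dvd_pow_self p hm0))
    (by simpa using hs.of_dvd hne' hd)
  rw [hset, Nat.card_eq_fintype_card, key,
    FiniteField.X_pow_card_pow_sub_X_natDegree_eq K hm0 hp.out.one_lt]

section Semilinear

variable {F V : Type*} [Field F] [AddCommGroup V] [Module F V] [Finite V]

theorem finrank_quotient_ne_one_of_invariant (f : V →+ V)
    (hf : ∀ (a : F) (v : V), f (a • v) = a ^ 2 • f v)
    (hinj : Function.Injective f) (hfix : ∀ v, f v = v → v = 0)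
    (W : Submodule F V) (hW : ∀ w ∈ W, f w ∈ W) : Module.finrank F (V ⧸ W) ≠ 1 := by
  intro h1
  obtain ⟨v', hv', hspan⟩ := finrank_eq_one_iff'.1 h1
  obtain ⟨v, rfl⟩ := W.mkQ_surjective v'
  have hvW : v ∉ W := by simpa using hv'
  have hbij : ∀ g : V →+ V, Function.Injective g → (∀ w ∈ W, g w ∈ W) →
      ∀ u, g u ∈ W → u ∈ W := by
    intro g hg hgW u hu
    have hsurj : Function.Surjective (fun w : W => (⟨g w, hgW w w.2⟩ : W)) :=
      Finite.surjective_of_injective fun a b hab => Subtype.ext (hg (congrArg Subtype.val hab))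
    obtain ⟨w, hw⟩ := hsurj ⟨g u, hu⟩
    rw [← hg (congrArg Subtype.val hw)]
    exact w.2
  obtain ⟨μ, hμ⟩ := hspan (W.mkQ (f v))
  have hdiff : f v - μ • v ∈ W := by
    rw [← map_smul] at hμ
    exact (Submodule.Quotient.eq W).1 hμ.symm
  have hμ0 : μ ≠ 0 := by
    rintro rfl
    exact hvW (hbij f hinj hW v (by simpa using hdiff))
  have hmem : (f - AddMonoidHom.id V) (μ⁻¹ • v) ∈ W := by
    have : (f - AddMonoidHom.id V) (μ⁻¹ • v) = μ⁻¹ ^ 2 • (f v - μ • v) := by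
      rw [smul_sub, smul_smul, AddMonoidHom.sub_apply, hf, AddMonoidHom.id_apply]
      congr 2
      field_simp
    rw [this]
    exact W.smul_mem _ hdiff
  have hmem' := hbij (f - AddMonoidHom.id V)
    ((injective_iff_map_eq_zero _).2 fun a ha => hfix a (sub_eq_zero.1 ha))
    (fun w hw => W.sub_mem (hW w hw) hw) _ hmem
  exact hvW ((W.smul_mem_iff (inv_ne_zero hμ0)).1 hmem')

theorem semilinear_apply_apply_ne_of_finrank_eq_three (hV : Module.finrank F V = 3) (f : V →+ V)
    (hf : ∀ (a : F) (v : V), f (a • v) = a ^ 2 • f v)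
    (hinj : Function.Injective f) (hfix : ∀ v, f v = v → v = 0)
    {x : V} (hx : x ≠ 0) (hfx : ∀ a : F, f x ≠ a • x) (a c : F) :
    f (f x) ≠ a • f x + c • x := by
  intro h
  have hli : LinearIndependent F ![x, f x] := by
    rw [LinearIndependent.pair_iff' hx]
    exact fun r hr => hfx r hr.symm
  have h2 : Module.finrank F (Submodule.span F (Set.range ![x, f x])) = 2 := by
    rw [finrank_span_eq_card hli, Fintype.card_fin]
  refine finrank_quotient_ne_one_of_invariant f hf hinj hfix
    (Submodule.span F (Set.range ![x, f x])) ?_ ?_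
  · intro w hw
    simp only [Matrix.range_cons, Matrix.range_empty, Set.union_empty, Set.singleton_union,
      Submodule.mem_span_pair] at hw ⊢
    obtain ⟨r, s, rfl⟩ := hw
    refine ⟨s ^ 2 * c, r ^ 2 + s ^ 2 * a, ?_⟩
    rw [map_add, hf, hf, h]
    module
  · have := Module.Finite.of_finite (R := F) (M := V)
    have := (Submodule.span F (Set.range ![x, f x])).finrank_quotient_add_finrank
    omega

end Semilinear

section Twisted

variable {K : Type*} [Field K] {σ : K →+* K}

/-- The fixed points of `σ³`, as a vector space over the fixed field of `σ`. -/
def cubeFixed (σ : K →+* K) : Submodule (σ.eqLocusField (RingHom.id K)) K where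
  carrier := {x | σ (σ (σ x)) = x}
  add_mem' {x y} hx hy := by simp_all
  zero_mem' := by simp
  smul_mem' a x hx := by
    have ha : σ a = a := a.2
    simp_all [Subfield.smul_def]

theorem eq_zero_of_add_mul_eq_zero {ω : K} (hω : σ (σ ω) = ω) (hω' : σ ω ≠ ω) {p r : K}
    (hp : σ (σ (σ p)) = p) (hr : σ (σ (σ r)) = r) (h : p + r * ω = 0) : p = 0 ∧ r = 0 := by
  have h' := congrArg (fun z => σ (σ (σ z))) h
  simp only [map_add, map_mul, map_zero, hp, hr, hω] at h'
  have hr0 : r = 0 := by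
    have : r * (σ ω - ω) = 0 := by linear_combination h' - h
    exact (mul_eq_zero.1 this).resolve_right (sub_ne_zero.2 hω')
  subst hr0
  exact ⟨by simpa using h, rfl⟩

theorem exists_eq_add_mul {ω : K} (hω : σ (σ ω) = ω) (hω' : σ ω ≠ ω) {l : K}
    (hl : σ (σ l) = l) : ∃ c d, σ c = c ∧ σ d = d ∧ l = c + d * ω := by
  have hne : σ ω - ω ≠ 0 := sub_ne_zero.2 hω'
  have hne' : ω - σ ω ≠ 0 := sub_ne_zero.2 hω'.symm
  have hd : σ ((σ l - l) / (σ ω - ω)) = (σ l - l) / (σ ω - ω) := by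
    simp only [map_div₀, map_sub, hl, hω]
    rw [div_eq_div_iff hne' hne]
    ring
  refine ⟨l - (σ l - l) / (σ ω - ω) * ω, (σ l - l) / (σ ω - ω), ?_, hd, by ring⟩
  rw [map_sub, map_mul, hd]
  field_simp
  ring

variable [CharP K 2]

/-- The additive map `x ↦ x² + b σ²(x)²`. -/
def twistedMap (σ : K →+* K) (b : K) : K →+ K :=
  (frobenius K 2 : K →+ K) +
    (AddMonoidHom.mulLeft b).comp ((frobenius K 2).comp (σ.comp σ) : K →+ K)

variable {b : K}

theorem twistedMap_apply (x : K) : twistedMap σ b x = x ^ 2 + b * (σ (σ x)) ^ 2 := by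
  simp [twistedMap, frobenius_def]

theorem twistedMap_mul {a : K} (ha : σ a = a) (x : K) :
    twistedMap σ b (a * x) = a ^ 2 * twistedMap σ b x := by
  simp only [twistedMap_apply, map_mul, ha]
  ring

theorem map_twistedMap (hb : σ (σ (σ b)) = b) {x : K} (hx : σ (σ (σ x)) = x) :
    σ (σ (σ (twistedMap σ b x))) = twistedMap σ b x := by
  simp only [twistedMap_apply, map_mul, map_add, map_pow, hx, hb]

theorem eq_zero_of_twistedMap_eq_zero (hnorm : b * σ b * σ (σ b) ≠ 1) {x : K}
    (hx : σ (σ (σ x)) = x) (h : twistedMap σ b x = 0) : x = 0 := by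
  rw [twistedMap_apply, CharTwo.add_eq_zero] at h
  have h1 := congrArg σ h
  have h2 := congrArg σ h1
  simp only [map_mul, map_pow, hx] at h1 h2
  by_contra hx0
  apply hnorm
  have hs : σ x ≠ 0 := by simpa using hx0
  have hss : σ (σ x) ≠ 0 := by simpa using hx0
  have hP : x ^ 2 * σ x ^ 2 * σ (σ x) ^ 2 ≠ 0 := by simp [hx0]
  apply mul_right_cancel₀ hP
  calc b * σ b * σ (σ b) * (x ^ 2 * σ x ^ 2 * σ (σ x) ^ 2)
      = (b * σ (σ x) ^ 2) * (σ b * x ^ 2) * (σ (σ b) * σ x ^ 2) := by ring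
    _ = 1 * (x ^ 2 * σ x ^ 2 * σ (σ x) ^ 2) := by rw [← h, ← h1, ← h2]; ring

theorem twistedMap_twistedMap_ne [Finite K] {q : ℕ}
    (hF : Nat.card (σ.eqLocusField (RingHom.id K)) = q) (hE : Nat.card (cubeFixed σ) = q ^ 3)
    (hb : σ (σ (σ b)) = b) (hnorm : b * σ b * σ (σ b) ≠ 1)
    (hcond : ∀ x, σ (σ (σ x)) = x → x ≠ 0 → ∀ a, σ a = a → twistedMap σ b x ≠ a * x)
    {x : K} (hx : σ (σ (σ x)) = x) (hx0 : x ≠ 0) {a c : K} (ha : σ a = a) (hc : σ c = c) :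
    twistedMap σ b (twistedMap σ b x) ≠ a * twistedMap σ b x + c * x := by
  let f : cubeFixed σ →+ cubeFixed σ :=
    ((twistedMap σ b).comp (cubeFixed σ).subtype.toAddMonoidHom).codRestrict (cubeFixed σ)
      fun v => map_twistedMap hb v.2
  have hfv (v : cubeFixed σ) : (f v : K) = twistedMap σ b v := rfl
  have hrank : Module.finrank (σ.eqLocusField (RingHom.id K)) (cubeFixed σ) = 3 := by
    have h := Module.natCard_eq_pow_finrank (K := σ.eqLocusField (RingHom.id K))
      (V := cubeFixed σ)
    rw [hE, hF] at h
    exact (Nat.pow_right_injective (hF ▸ Finite.one_lt_card) h).symm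
  have key := semilinear_apply_apply_ne_of_finrank_eq_three hrank f
    (fun r v => Subtype.ext (twistedMap_mul r.2 v))
    ((injective_iff_map_eq_zero f).2 fun v hv => Subtype.ext
      (eq_zero_of_twistedMap_eq_zero hnorm v.2 (congrArg Subtype.val hv)))
    (fun v hv => by
      by_contra hv0
      refine hcond v v.2 (by simpa using hv0) 1 (map_one σ) ?_
      rw [← hfv, hv, one_mul])
    (x := ⟨x, hx⟩) (by simpa [Subtype.ext_iff] using hx0)
    (fun r hr => hcond x hx hx0 r r.2 (congrArg Subtype.val hr)) ⟨a, ha⟩ ⟨c, hc⟩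
  exact fun h => key (Subtype.ext h)

theorem sq_eq_self_of_twistedMap_add_mul_eq [Finite K] {q : ℕ}
    (hF : Nat.card (σ.eqLocusField (RingHom.id K)) = q) (hE : Nat.card (cubeFixed σ) = q ^ 3)
    (hb : σ (σ (σ b)) = b) (hnorm : b * σ b * σ (σ b) ≠ 1)
    (hcond : ∀ x, σ (σ (σ x)) = x → x ≠ 0 → ∀ a, σ a = a → twistedMap σ b x ≠ a * x)
    {ω : K} (hω : σ (σ ω) = ω) (hω' : σ ω ≠ ω)
    {x y l : K} (hx : σ (σ (σ x)) = x) (hx0 : x ≠ 0) (hy : σ (σ (σ y)) = y) (hl : σ (σ l) = l)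
    (h : twistedMap σ b y + y * ω = l * (twistedMap σ b x + x * ω)) : l ^ 2 = l := by
  obtain ⟨c, d, hc, hd, rfl⟩ := exists_eq_add_mul hω hω' hl
  obtain ⟨s, hs, hs'⟩ : ∃ s, σ s = s ∧ s = ω + σ ω := ⟨_, by rw [map_add, hω, add_comm], rfl⟩
  obtain ⟨t, ht, ht'⟩ : ∃ t, σ t = t ∧ t = ω * σ ω := ⟨_, by rw [map_mul, hω, mul_comm], rfl⟩
  have h2 : (2 : K) = 0 := CharTwo.two_eq_zero
  have hfx := map_twistedMap hb hx
  have hfy := map_twistedMap hb hy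
  obtain ⟨h1, h1'⟩ := eq_zero_of_add_mul_eq_zero hω hω'
    (p := twistedMap σ b y + c * twistedMap σ b x + d * t * x)
    (r := y + c * x + d * s * x + d * twistedMap σ b x)
    (by simp only [map_add, map_mul, hfx, hfy, hx, hc, hd, ht])
    (by simp only [map_add, map_mul, hfx, hx, hy, hc, hd, hs])
    (by
      subst hs' ht'
      linear_combination h + (c * twistedMap σ b x + c * x * ω + d * twistedMap σ b x * ω +
        d * ω * x * σ ω + d * ω ^ 2 * x) * h2)
  have hyx : y = (c + d * s) * x + d * twistedMap σ b x := by
    linear_combination h1' - ((c + d * s) * x + d * twistedMap σ b x) * h2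
  have hcds : σ (c + d * s) = c + d * s := by simp only [map_add, map_mul, hc, hd, hs]
  rw [hyx, map_add, twistedMap_mul hcds, twistedMap_mul hd] at h1
  rcases eq_or_ne d 0 with rfl | hd0
  · have hfx0 : twistedMap σ b x ≠ 0 := fun h0 =>
      hx0 (eq_zero_of_twistedMap_eq_zero hnorm hx h0)
    have : (c ^ 2 - c) * twistedMap σ b x = 0 := by
      linear_combination h1 - c * twistedMap σ b x * h2
    have := (mul_eq_zero.1 this).resolve_right hfx0
    linear_combination this
  · refine absurd ?_ (twistedMap_twistedMap_ne hF hE hb hnorm hcond hx hx0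
      (a := -((c + d * s) ^ 2 + c) / d ^ 2) (c := -(d * t) / d ^ 2)
      (by simp only [map_div₀, map_neg, map_add, map_mul, map_pow, hc, hd, hs])
      (by simp only [map_div₀, map_neg, map_mul, map_pow, hd, ht]))
    field_simp
    linear_combination h1

end Twisted

/-- Theorem 3.10 of the paper: for suitable b ∈ GF(2^{3n})* and
ω ∈ GF(2^{2n}) \ GF(2^n), the set
L_U = { GF(2^{2n})·(x² + b x^{2^{2n+1}} + xω) : x ∈ GF(2^{3n})* } is a scattered
F_2-linear set of rank 3n of PG(2, 2^{2n}) = PG(GF(2^{6n}), GF(2^{2n})). -/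
theorem stmt12 (n : ℕ) (hn : 1 < n)
    (K : Type*) [Field K] [Fintype K] (hK : Nat.card K = 2 ^ (6 * n))
    (b : K) (hb : b ^ 2 ^ (3 * n) = b) (hb0 : b ≠ 0)
    (hbnorm : b ^ (1 + 2 ^ n + 2 ^ (2 * n)) ≠ 1)
    (hbcond : ∀ x : K, x ^ 2 ^ (3 * n) = x → x ≠ 0 →
      (x + b * x ^ (2 ^ (2 * n + 1) - 1)) ^ 2 ^ n ≠ x + b * x ^ (2 ^ (2 * n + 1) - 1))
    (ω : K) (hω1 : ω ^ 2 ^ (2 * n) = ω) (hω2 : ω ^ 2 ^ n ≠ ω)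
    (U : Set K)
    (hU : U = {z : K | ∃ x : K, x ^ 2 ^ (3 * n) = x ∧
        z = x ^ 2 + b * x ^ 2 ^ (2 * n + 1) + x * ω}) :
    Nat.card U = 2 ^ (3 * n) ∧
    (∀ u ∈ U, u ≠ 0 → ∀ v ∈ U, v ≠ 0 → ∀ l : K,
        l ^ 2 ^ (2 * n) = l → v = l * u → l ^ 2 = l) := by
  have : CharP K 2 := charP_of_card_eq_prime_pow (f := 6 * n)
    (by rw [← Nat.card_eq_fintype_card, hK])
  let σ : K →+* K := iterateFrobenius K 2 n
  have hσ (x : K) : σ x = x ^ 2 ^ n := iterateFrobenius_def 2 n x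
  have hσσ (x : K) : x ^ 2 ^ (2 * n) = σ (σ x) := by
    rw [hσ, hσ, ← pow_mul, ← pow_add, two_mul]
  have hσσσ (x : K) : x ^ 2 ^ (3 * n) = σ (σ (σ x)) := by
    rw [hσ, hσ, hσ, ← pow_mul, ← pow_mul, ← pow_add, ← pow_add]
    ring_nf
  have hσsq (x : K) : x ^ 2 ^ (2 * n + 1) = (σ (σ x)) ^ 2 := by
    rw [pow_succ, pow_mul, hσσ]
  have hF : Nat.card (σ.eqLocusField (RingHom.id K)) = 2 ^ n := by
    rw [← FiniteField.natCard_setOf_pow_eq_self hK (by omega) (Dvd.intro_left 6 rfl)]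
    rfl
  have hE : Nat.card {x : K | x ^ 2 ^ (3 * n) = x} = 2 ^ (3 * n) :=
    FiniteField.natCard_setOf_pow_eq_self hK (by omega) ⟨2, by ring⟩
  have hE' : Nat.card (cubeFixed σ) = (2 ^ n) ^ 3 := by
    rw [← pow_mul, mul_comm n 3, ← hE]
    simp only [hσσσ]
    rfl
  have hnorm : b * σ b * σ (σ b) ≠ 1 := by
    rwa [← hσσ, hσ, ← pow_succ', ← pow_add, add_comm (2 ^ n)]
  have hcond (x : K) (hx : σ (σ (σ x)) = x) (hx0 : x ≠ 0) (a : K) (ha : σ a = a) :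
      twistedMap σ b x ≠ a * x := by
    intro h
    have hz : x + b * x ^ (2 ^ (2 * n + 1) - 1) = a := by
      apply mul_right_cancel₀ hx0
      rw [← h, twistedMap_apply, ← hσsq, add_mul, mul_assoc, ← pow_succ,
        Nat.sub_add_cancel Nat.one_le_two_pow, sq]
    refine hbcond x (by rw [hσσσ, hx]) hx0 ?_
    rw [hz, ← hσ, ha]
  rw [hσσσ] at hb
  rw [hσσ] at hω1
  rw [← hσ] at hω2
  have hU' : U = (fun x => twistedMap σ b x + x * ω) '' {x : K | x ^ 2 ^ (3 * n) = x} := by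
    ext z
    simp only [hU, Set.mem_ofPred_eq, Set.mem_image, twistedMap_apply, hσsq]
    exact exists_congr fun x => and_congr_right fun _ => eq_comm
  subst hU'
  clear hU
  constructor
  · rw [Nat.card_image_of_injOn, hE]
    intro x hx y hy hxy
    rw [Set.mem_ofPred_eq, hσσσ] at hx hy
    have hsub : σ (σ (σ (x - y))) = x - y := by simp only [map_sub, hx, hy]
    refine sub_eq_zero.1 (eq_zero_of_add_mul_eq_zero hω1 hω2 (map_twistedMap hb hsub) hsub ?_).2
    rw [map_sub]
    linear_combination hxy
  · rintro _ ⟨x, hx, rfl⟩ hu _ ⟨y, hy, rfl⟩ - l hl h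
    rw [Set.mem_ofPred_eq, hσσσ] at hx hy
    rw [hσσ] at hl
    refine sq_eq_self_of_twistedMap_add_mul_eq hF hE' hb hnorm hcond hω1 hω2 hx ?_ hy hl h
    rintro rfl
    exact hu (by simp)
end

section
/- Let q = 2^t with t > 1. A translation cap K_G in AG(r, q) has size at most q^{r/2}; equivalently, an additive subgroup G of GF(q)^r in which any two distinct nonzero vectors are GF(q)-linearly independent has |G| ≤ q^{r/2}. -/
open Finset Matrix in
/-- The number of `a` whose dot product with a fixed vector `g` vanishes. -/
theorem card_mul_card_dotProduct_eq_zero {ι K : Type*} [Fintype ι] [DecidableEq ι] [Field K]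
    [Fintype K] [DecidableEq K] (g : ι → K) :
    (Fintype.card K : ℤ) * #{a : ι → K | a ⬝ᵥ g = 0} =
      Fintype.card (ι → K) * (1 + (Fintype.card K - 1) * if g = 0 then 1 else 0) := by
  split_ifs with hg
  · simp [hg, mul_comm]
  obtain ⟨i, hi⟩ : ∃ i, g i ≠ 0 := by
    by_contra! h
    exact hg (funext h)
  let f : (ι → K) →+ K := AddMonoidHom.mk' (fun a ↦ a ⬝ᵥ g) fun a b ↦ add_dotProduct a b g
  have hf : Function.Surjective f := fun x ↦ ⟨Pi.single i (x / g i), by simp [f, hi]⟩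
  have h := f.ker.card_mul_index
  rw [AddSubgroup.index_ker, AddMonoidHom.range_eq_top.2 hf,
    Nat.card_congr AddSubgroup.topEquiv.toEquiv] at h
  have hker : Nat.card f.ker = #{a : ι → K | a ⬝ᵥ g = 0} :=
    Nat.subtype_card _ (by simp [f, AddMonoidHom.mem_ker])
  rw [hker, Nat.card_eq_fintype_card, Nat.card_eq_fintype_card] at h
  rw [← h]
  push_cast
  ring

open Finset Matrix in
/-- The number of `a` whose dot products with two linearly independent vectors vanish. -/
theorem card_sq_mul_card_dotProduct_eq_zero {ι K : Type*} [Fintype ι] [DecidableEq ι] [Field K]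
    [Fintype K] [DecidableEq K] {u v : ι → K} (hu : u ≠ 0) (huv : ∀ l : K, v ≠ l • u) :
    Fintype.card K ^ 2 * #{a : ι → K | a ⬝ᵥ u = 0 ∧ a ⬝ᵥ v = 0} = Fintype.card (ι → K) := by
  obtain ⟨i, hi⟩ : ∃ i, u i ≠ 0 := by
    by_contra! h
    exact hu (funext h)
  obtain ⟨j, hj⟩ : ∃ j, u i * v j - u j * v i ≠ 0 := by
    by_contra! h
    refine huv (v i / u i) (funext fun j ↦ ?_)
    simp only [Pi.smul_apply, smul_eq_mul]
    field_simp
    linear_combination h j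
  let f : (ι → K) →+ K × K := AddMonoidHom.mk' (fun a ↦ (a ⬝ᵥ u, a ⬝ᵥ v)) fun a b ↦ by
    simp [add_dotProduct]
  have hf : Function.Surjective f := by
    rintro ⟨x, y⟩
    refine ⟨Pi.single i ((x * v j - y * u j) / (u i * v j - u j * v i)) +
      Pi.single j ((y * u i - x * v i) / (u i * v j - u j * v i)), ?_⟩
    simp only [f, AddMonoidHom.mk'_apply, add_dotProduct, single_dotProduct, Prod.mk.injEq]
    constructor <;>
      rw [div_mul_eq_mul_div, div_mul_eq_mul_div, ← add_div, div_eq_iff hj] <;> ring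
  have h := f.ker.card_mul_index
  rw [AddSubgroup.index_ker, AddMonoidHom.range_eq_top.2 hf,
    Nat.card_congr AddSubgroup.topEquiv.toEquiv] at h
  have hker : Nat.card f.ker = #{a : ι → K | a ⬝ᵥ u = 0 ∧ a ⬝ᵥ v = 0} :=
    Nat.subtype_card _ (by simp [f, AddMonoidHom.mem_ker])
  rw [hker, Nat.card_prod, Nat.card_eq_fintype_card, Nat.card_eq_fintype_card] at h
  rw [← h]
  ring

open Finset Matrix in
/-- The size of the kernel of `a ⬝ᵥ ·` on `G` is `|G| / q` or at least `2 |G| / q`. -/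
theorem zero_le_card_dotProduct_sub_mul_sub {ι K : Type*} [Fintype ι] [Field K]
    [Fintype K] [DecidableEq K] (G : AddSubgroup (ι → K)) [Fintype G] (a : ι → K) :
    0 ≤ ((Fintype.card K : ℤ) * #{g : G | a ⬝ᵥ g.1 = 0} - Fintype.card G) *
      (Fintype.card K * #{g : G | a ⬝ᵥ g.1 = 0} - 2 * Fintype.card G) := by
  let f : G →+ K := AddMonoidHom.mk' (fun g ↦ a ⬝ᵥ g.1) fun g h ↦ by simp [dotProduct_add]
  have h := f.ker.card_mul_index
  rw [AddSubgroup.index_ker] at h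
  obtain ⟨m, hm⟩ := f.range.card_addSubgroup_dvd_card
  have hker : Nat.card f.ker = #{g : G | a ⬝ᵥ g.1 = 0} :=
    Nat.subtype_card _ (by simp [f, AddMonoidHom.mem_ker])
  rw [hker, Nat.card_eq_fintype_card (α := G)] at h
  rw [Nat.card_eq_fintype_card (α := K)] at hm
  have key : (0 : ℤ) ≤ (m - 1) * (m - 2) := by
    obtain hm1 | hm2 : m ≤ 1 ∨ 2 ≤ m := by omega
    · exact mul_nonneg_of_nonpos_of_nonpos (by omega) (by omega)
    · exact mul_nonneg (by omega) (by omega)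
  rw [hm, ← h]
  push_cast
  calc (0 : ℤ) ≤ (#{g : G | a ⬝ᵥ g.1 = 0} * Nat.card f.range) ^ 2 * ((m - 1) * (m - 2)) :=
        mul_nonneg (sq_nonneg _) key
    _ = _ := by ring

open Finset Matrix in
/-- The rank bound for scattered subgroups, in terms of cardinalities. -/
theorem AddSubgroup.card_sq_le_of_pairwise_independent {ι K : Type*} [Fintype ι] [Field K]
    [Fintype K] (hK : 2 < Fintype.card K) (G : AddSubgroup (ι → K))
    (hind : ∀ u ∈ G, ∀ v ∈ G, u ≠ 0 → v ≠ 0 → u ≠ v → ∀ l : K, v ≠ l • u) :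
    Nat.card G ^ 2 ≤ Nat.card (ι → K) := by
  classical
  have := Fintype.ofFinite G
  simp only [Nat.card_eq_fintype_card]
  let h : (ι → K) → ℤ := fun a ↦ #{g : G | a ⬝ᵥ g.1 = 0}
  set q : ℤ := (Fintype.card K : ℤ) with hq
  set Q : ℤ := (Fintype.card (ι → K) : ℤ) with hQ
  set N : ℤ := (Fintype.card G : ℤ) with hN
  have hpair (u v : G) : q ^ 2 * #{a : ι → K | a ⬝ᵥ u.1 = 0 ∧ a ⬝ᵥ v.1 = 0} =
      Q * (1 + (q - 1) * ((if u = 0 then 1 else 0) + (if v = 0 then 1 else 0) +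
        (if u = v then 1 else 0)) +
        (q - 1) * (q - 2) * ((if u = 0 then 1 else 0) * (if v = 0 then 1 else 0))) := by
    have hu := card_mul_card_dotProduct_eq_zero u.1
    have hv := card_mul_card_dotProduct_eq_zero v.1
    rw [← hq, ← hQ] at hu hv
    simp only [ZeroMemClass.coe_eq_zero] at hu hv
    by_cases hu0 : u = 0
    · subst hu0
      by_cases hv0 : v = 0
      · subst hv0
        simp [hQ]
        ring
      · simp only [hv0, Ne.symm hv0, if_true, if_false] at hv ⊢
        simp only [ZeroMemClass.coe_zero, dotProduct_zero, true_and]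
        linear_combination q * hv
    · by_cases hv0 : v = 0
      · subst hv0
        simp only [hu0, if_true, if_false] at hu ⊢
        simp only [ZeroMemClass.coe_zero, dotProduct_zero, and_true]
        linear_combination q * hu
      · by_cases huv : u = v
        · subst huv
          simp only [hu0, if_true, if_false, and_self] at hu ⊢
          linear_combination q * hu
        · have := card_sq_mul_card_dotProduct_eq_zero (u := u.1) (v := v.1) (by simpa)
            (hind _ u.2 _ v.2 (by simpa) (by simpa) (mt Subtype.ext huv))
          zify at this
          simp only [hu0, hv0, huv, if_false]
          linear_combination this
  have hsum : q * ∑ a, h a = Q * (N + (q - 1)) := by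
    have : ∑ a, h a = ∑ g : G, (#{a : ι → K | a ⬝ᵥ g.1 = 0} : ℤ) := by
      simp only [h, card_filter, Nat.cast_sum]
      exact sum_comm
    rw [this, mul_sum, sum_congr rfl fun g _ ↦ card_mul_card_dotProduct_eq_zero g.1]
    simp only [ZeroMemClass.coe_eq_zero, ← mul_sum, sum_add_distrib]
    simp [hN, hQ, hq]
  have hsum_sq : q ^ 2 * ∑ a, h a ^ 2 =
      Q * (N ^ 2 + 3 * N * (q - 1) + (q - 1) * (q - 2)) := by
    have : ∑ a, h a ^ 2 =
        ∑ u : G, ∑ v : G, (#{a : ι → K | a ⬝ᵥ u.1 = 0 ∧ a ⬝ᵥ v.1 = 0} : ℤ) := by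
      simp only [h, card_filter, Nat.cast_sum, sq, sum_mul_sum]
      rw [sum_comm]
      refine sum_congr rfl fun u _ ↦ ?_
      rw [sum_comm]
      refine sum_congr rfl fun v _ ↦ sum_congr rfl fun a _ ↦ ?_
      split_ifs <;> simp_all
    simp_rw [this, mul_sum, hpair, ← mul_sum, sum_add_distrib, ← mul_sum, sum_add_distrib]
    simp [← hN, -mul_eq_mul_left_iff]
    ring
  have htotal : ∑ a, (q * h a - N) * (q * h a - 2 * N) = Q * ((q - 1) * (q - 2)) := by
    have : ∀ a, (q * h a - N) * (q * h a - 2 * N) =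
        q ^ 2 * h a ^ 2 - 3 * N * (q * h a) + 2 * N ^ 2 := fun a ↦ by ring
    simp_rw [this, sum_add_distrib, sum_sub_distrib, ← mul_sum, hsum, hsum_sq]
    simp [hQ]
    ring
  have hle := single_le_sum (fun a _ ↦ zero_le_card_dotProduct_sub_mul_sub G a) (mem_univ 0)
  have h0 : h 0 = N := by simp [h, hN]
  change (q * h 0 - N) * (q * h 0 - 2 * N) ≤ ∑ a, (q * h a - N) * (q * h a - 2 * N) at hle
  rw [htotal, h0] at hle
  have hpos : 0 < (q - 1) * (q - 2) := by
    have : (2 : ℤ) < q := by rw [hq]; exact_mod_cast hK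
    exact mul_pos (by linarith) (by linarith)
  have : N ^ 2 ≤ Q := le_of_mul_le_mul_right (by linarith) hpos
  rw [hN, hQ] at this
  exact_mod_cast this

/-- \cite[Proposition 2.5]{Giulietti2007}: a translation cap in
AG(r, q), q = 2^t, has size at most q^{r/2}, i.e. an additive subgroup G of
GF(q)^r in which any two distinct nonzero vectors are GF(q)-independent
satisfies |G| ≤ 2^{rt/2}. -/
theorem stmt18 (t r : ℕ) (ht : 1 < t)
    (K : Type*) [Field K] [Fintype K] (hK : Nat.card K = 2 ^ t)
    (G : AddSubgroup (Fin r → K))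
    (hind : ∀ u ∈ G, ∀ v ∈ G, u ≠ 0 → v ≠ 0 → u ≠ v → ∀ l : K, v ≠ l • u) :
    Nat.card G ≤ 2 ^ ((r * t) / 2) := by
  have hq : Fintype.card K = 2 ^ t := by rw [← hK, Nat.card_eq_fintype_card]
  have h2 : 2 < Fintype.card K := by
    rw [hq]
    calc 2 < 2 ^ 2 := by norm_num
      _ ≤ 2 ^ t := Nat.pow_le_pow_right two_pos ht
  have hsq := G.card_sq_le_of_pairwise_independent h2 hind
  have hV : Nat.card (Fin r → K) = 2 ^ (r * t) := by
    simp [hq, ← pow_mul, mul_comm]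
  obtain ⟨k, -, hk⟩ := (Nat.dvd_prime_pow Nat.prime_two).1 (hV ▸ G.card_addSubgroup_dvd_card)
  rw [hV, hk, ← pow_mul] at hsq
  rw [hk]
  refine Nat.pow_le_pow_right two_pos ?_
  have := (Nat.pow_le_pow_iff_right one_lt_two).1 hsq
  omega
end
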